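/- arXiv:1911.03566 — 2 statements merged into one kernel-verified Lean document; each statement's English description precedes it below -/
import Mathlib

section
/- Let t ≥ 1, let H be a full, finitely generated additive submonoid of ℕ^t, let x be an atom of H, and let m, n be integers with 2 ≤ m < n such that s_i(x) = 1 for all 1 ≤ i < m, s_i(x) = 3 for all m ≤ i < n, and s_n(x) = 4. Then m does not divide n. -/
/-- `a` is an atom (irreducible element) of the additive submonoid `H`. -/
def IsAtomOf {M : Type*} [AddCommMonoid M] (H : AddSubmonoid M) (a : M) : Prop :=
  a ∈ H ∧ a ≠ 0 ∧ ∀ b c : M, b ∈ H → c ∈ H → a = b + c → b = 0 ∨ c = 0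

/-- `b` divides `v` in the additive submonoid `H`. -/
def DividesIn {M : Type*} [AddCommMonoid M] (H : AddSubmonoid M) (b v : M) : Prop :=
  ∃ c ∈ H, v = b + c

/-- `sSeq H a n` is the number of atoms of `H` dividing `n • a` in `H`
(the `n`th entry of the divisor sequence of `a`). -/
noncomputable def sSeq {M : Type*} [AddCommMonoid M] (H : AddSubmonoid M) (a : M) (n : ℕ) : ℕ :=
  {b : M | IsAtomOf H b ∧ DividesIn H b (n • a)}.ncard

/-- `H` is a full submonoid of `ι → ℕ`. -/
def IsFull {ι : Type*} (H : AddSubmonoid (ι → ℕ)) : Prop :=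
  ∀ u ∈ H, ∀ v ∈ H, u ≤ v → v - u ∈ H

/-- Coordinatewise coercion `(ι → ℕ) → (ι → ℤ)`. -/
def natIntMap {ι : Type*} : (ι → ℕ) → (ι → ℤ) := fun f i => (f i : ℤ)

/-- `H` is a normal submonoid of `ι → ℕ`. -/
def IsNormal {ι : Type*} (H : AddSubmonoid (ι → ℕ)) : Prop :=
  ∀ g : ι → ℤ, g ∈ AddSubgroup.closure (natIntMap '' (H : Set (ι → ℕ))) →
    (∃ N : ℕ, 1 ≤ N ∧ N • g ∈ natIntMap '' (H : Set (ι → ℕ))) →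
    g ∈ natIntMap '' (H : Set (ι → ℕ))

/-- Outer (tensor) product of two vectors of naturals. -/
def outer {t₁ t₂ : ℕ} (u : Fin t₁ → ℕ) (v : Fin t₂ → ℕ) : Fin t₁ × Fin t₂ → ℕ :=
  fun p => u p.1 * v p.2

/-- The glom `G(H₁, H₂)`: the additive submonoid generated by
`x₀ ⊠ y₀`, `xᵢ ⊠ y₀` and `x₀ ⊠ yⱼ`. -/
def glom {t₁ t₂ m n' : ℕ} (x : Fin (m + 1) → Fin t₁ → ℕ) (y : Fin (n' + 1) → Fin t₂ → ℕ) :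
    AddSubmonoid (Fin t₁ × Fin t₂ → ℕ) :=
  AddSubmonoid.closure
    (Set.range (fun i => outer (x i) (y 0)) ∪ Set.range (fun j => outer (x 0) (y j)))

/-- An atom of a reduced multiplicative monoid. -/
def IsMulAtom {H : Type*} [CommMonoid H] (a : H) : Prop :=
  a ≠ 1 ∧ ∀ b c : H, a = b * c → b = 1 ∨ c = 1

/-- The monoid `H` of multisets over `P` whose image under `φ` sums to zero. -/
def Hmon {P : Type*} {G : Type*} [AddCommGroup G] (φ : P → G) : AddSubmonoid (Multiset P) where
  carrier := {x | (x.map φ).sum = 0}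
  zero_mem' := by simp
  add_mem' := by
    intro a b ha hb
    simp only [Set.mem_setOf_eq, Multiset.map_add, Multiset.sum_add] at *
    rw [ha, hb, add_zero]

/-- The block monoid of zero-sum multisets over `G` supported in `S`. -/
def Bmon {G : Type*} [AddCommGroup G] (S : Set G) : AddSubmonoid (Multiset G) where
  carrier := {y | (∀ g ∈ y, g ∈ S) ∧ y.sum = 0}
  zero_mem' := by simp
  add_mem' := by
    intro a b ha hb
    refine ⟨fun g hg => ?_, ?_⟩
    · rcases Multiset.mem_add.mp hg with h | h
      exacts [ha.1 g h, hb.1 g h]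
    · rw [Multiset.sum_add, ha.2, hb.2, add_zero]

/-- The block monoid `B(ℤ_n, {1, m})`. -/
def blockMon (n m : ℕ) : AddSubmonoid (Multiset (ZMod n)) where
  carrier := {A | (∀ g ∈ A, g = (1 : ZMod n) ∨ g = (m : ZMod n)) ∧ A.sum = 0}
  zero_mem' := by simp
  add_mem' := by
    intro a b ha hb
    refine ⟨fun g hg => ?_, ?_⟩
    · rcases Multiset.mem_add.mp hg with h | h
      exacts [ha.1 g h, hb.1 g h]
    · rw [Multiset.sum_add, ha.2, hb.2, add_zero]

/-- The submonoid `{(x, y, z) ∈ ℕ³ : x + y = 2z}`. -/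
def H19 : AddSubmonoid (ℕ × ℕ × ℕ) where
  carrier := {p | p.1 + p.2.1 = 2 * p.2.2}
  zero_mem' := by simp
  add_mem' := by
    intro p q hp hq
    simp only [Set.mem_setOf_eq, Prod.fst_add, Prod.snd_add] at *
    omega

section FullSubmonoid

variable {ι : Type*} {H : AddSubmonoid (ι → ℕ)}

lemma IsFull.dividesIn_iff (hH : IsFull H) {u v : ι → ℕ} (hu : u ∈ H) (hv : v ∈ H) :
    DividesIn H u v ↔ u ≤ v := by
  constructor
  · rintro ⟨c, -, rfl⟩
    exact le_self_add
  · intro h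
    exact ⟨v - u, hH u hu v hv h, (add_tsub_cancel_of_le h).symm⟩

/-- Distinct atoms of a full submonoid are incomparable. -/
lemma IsFull.atom_eq_of_le (hH : IsFull H) {a b : ι → ℕ} (ha : IsAtomOf H a)
    (hb : IsAtomOf H b) (h : a ≤ b) : a = b := by
  have e : b = a + (b - a) := (add_tsub_cancel_of_le h).symm
  rcases hb.2.2 a (b - a) ha.1 (hH a ha.1 b hb.1 h) e with h0 | h0
  · exact absurd h0 ha.2.1
  · rw [h0, add_zero] at e
    exact e.symm

/-- Distinct atoms of a full submonoid are not proportional. -/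
lemma IsFull.atom_eq_of_smul_eq (hH : IsFull H) {a b : ι → ℕ} (ha : IsAtomOf H a)
    (hb : IsAtomOf H b) {k l : ℕ} (hk : 1 ≤ k) (h : k • a = l • b) : a = b := by
  have hp (i : ι) : k * a i = l * b i := by simpa using congrFun h i
  rcases le_total l k with hlk | hkl
  · refine hH.atom_eq_of_le ha hb fun i => ?_
    refine Nat.le_of_mul_le_mul_left ?_ hk
    rw [hp i]
    exact Nat.mul_le_mul_right _ hlk
  · refine (hH.atom_eq_of_le hb ha fun i => ?_).symm
    refine Nat.le_of_mul_le_mul_left ?_ (hk.trans hkl)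
    rw [← hp i]
    exact Nat.mul_le_mul_right _ hkl

/-- If `p • a ≤ n • x` for distinct atoms `a` and `x`, then `p ≤ n`. -/
lemma IsFull.le_of_smul_le_smul (hH : IsFull H) {a x : ι → ℕ} (ha : IsAtomOf H a)
    (hx : IsAtomOf H x) (hne : a ≠ x) {p n : ℕ} (h : p • a ≤ n • x) : p ≤ n := by
  by_contra! hlt
  refine hne (hH.atom_eq_of_le ha hx fun i => ?_)
  have hp : p * a i ≤ n * x i := by simpa using h i
  refine Nat.le_of_mul_le_mul_left (hp.trans ?_) (Nat.zero_lt_of_lt hlt)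
  exact Nat.mul_le_mul_right _ hlt.le

/-- Any two distinct atoms of a full submonoid are linearly independent. -/
lemma IsFull.coeff_eq (hH : IsFull H) {x z : ι → ℕ} (hx : IsAtomOf H x)
    (hz : IsAtomOf H z) (hne : x ≠ z) {p q b c : ℕ}
    (h : p • x + b • z = q • x + c • z) : p = q := by
  have key : ∀ p q b c : ℕ, p • x + b • z = q • x + c • z → ¬ p < q := by
    intro p q b c h hlt
    refine hne (hH.atom_eq_of_smul_eq hx hz (k := q - p) (l := b - c) (by omega) ?_)
    funext i
    have hi : p * x i + b * z i = q * x i + c * z i := by simpa using congrFun h i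
    simp only [Pi.smul_apply, smul_eq_mul, Nat.sub_mul]
    have := Nat.mul_le_mul_right (x i) hlt.le
    omega
  have h1 := key p q b c h
  have h2 := key q p c b h.symm
  omega

/-- If `n • x = p • a + q • b` with atoms `a, b ≠ x`, then `x ≤ a + b`. -/
lemma IsFull.le_add_of_smul_eq (hH : IsFull H) {a b x : ι → ℕ} (ha : IsAtomOf H a)
    (hb : IsAtomOf H b) (hx : IsAtomOf H x) (hax : a ≠ x) (hbx : b ≠ x) {n p q : ℕ}
    (hn : 1 ≤ n) (h : n • x = p • a + q • b) : x ≤ a + b := by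
  have hp : p ≤ n := hH.le_of_smul_le_smul ha hx hax (h ▸ le_self_add)
  have hq : q ≤ n := hH.le_of_smul_le_smul hb hx hbx (h ▸ le_add_self)
  intro i
  have hi : n * x i = p * a i + q * b i := by simpa using congrFun h i
  refine Nat.le_of_mul_le_mul_left ?_ hn
  rw [hi, Pi.add_apply, mul_add]
  exact add_le_add (Nat.mul_le_mul_right _ hp) (Nat.mul_le_mul_right _ hq)

/-- Every element of `H` is a sum of atoms below it. -/
lemma mem_closure_atoms_le [Fintype ι] {u : ι → ℕ} (hu : u ∈ H) :
    u ∈ AddSubmonoid.closure {a | IsAtomOf H a ∧ a ≤ u} := by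
  induction hN : ∑ i, u i using Nat.strong_induction_on generalizing u with
  | _ N ih =>
    by_cases h0 : u = 0
    · rw [h0]
      exact zero_mem _
    by_cases hat : IsAtomOf H u
    · exact AddSubmonoid.subset_closure ⟨hat, le_rfl⟩
    have : ∃ b c, b ∈ H ∧ c ∈ H ∧ u = b + c ∧ b ≠ 0 ∧ c ≠ 0 := by
      by_contra! hcon
      refine hat ⟨hu, h0, fun b c hb hc hbc => ?_⟩
      by_cases hb0 : b = 0
      · exact Or.inl hb0
      · exact Or.inr (hcon b c hb hc hbc hb0)
    obtain ⟨b, c, hb, hc, rfl, hb0, hc0⟩ := this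
    have pos : ∀ v : ι → ℕ, v ≠ 0 → 0 < ∑ i, v i := by
      intro v hv
      obtain ⟨i, hi⟩ := Function.ne_iff.mp hv
      exact Finset.sum_pos' (fun _ _ => Nat.zero_le _)
        ⟨i, Finset.mem_univ _, Nat.pos_of_ne_zero hi⟩
    have hbp := pos b hb0
    have hcp := pos c hc0
    simp only [Pi.add_apply, Finset.sum_add_distrib] at hN
    refine add_mem ?_ ?_
    · exact AddSubmonoid.closure_mono (fun a (ha : IsAtomOf H a ∧ a ≤ b) =>
        (⟨ha.1, ha.2.trans le_self_add⟩ : IsAtomOf H a ∧ a ≤ b + c))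
        (ih _ (by omega) hb rfl)
    · exact AddSubmonoid.closure_mono (fun a (ha : IsAtomOf H a ∧ a ≤ c) =>
        (⟨ha.1, ha.2.trans le_add_self⟩ : IsAtomOf H a ∧ a ≤ b + c))
        (ih _ (by omega) hc rfl)

/-- If all atoms below `v` lie in `{x, y, z, w}`, then every `u ≤ v` in `H` is a combination
of `x, y, z, w`. -/
lemma exists_eq_combination_of_atoms_le [Fintype ι] {u v x y z w : ι → ℕ}
    (hu : u ∈ H) (huv : u ≤ v) (hS : ∀ a, IsAtomOf H a → a ≤ v → a = x ∨ a = y ∨ a = z ∨ a = w) :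
    ∃ a b c d : ℕ, u = a • x + b • y + c • z + d • w := by
  have hS' : {a | IsAtomOf H a ∧ a ≤ u} ⊆ {x, y, z, w} := fun a ha => hS a ha.1 (ha.2.trans huv)
  have h := AddSubmonoid.closure_mono hS' (mem_closure_atoms_le hu)
  clear hS' huv hu
  induction h using AddSubmonoid.closure_induction with
  | mem a ha =>
    rcases ha with rfl | rfl | rfl | rfl
    · exact ⟨1, 0, 0, 0, by simp⟩
    · exact ⟨0, 1, 0, 0, by simp⟩
    · exact ⟨0, 0, 1, 0, by simp⟩
    · exact ⟨0, 0, 0, 1, by simp⟩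
  | zero => exact ⟨0, 0, 0, 0, by simp⟩
  | add _ _ _ _ hu hv =>
    obtain ⟨a, b, c, d, rfl⟩ := hu
    obtain ⟨a', b', c', d', rfl⟩ := hv
    exact ⟨a + a', b + b', c + c', d + d', by module⟩

/-- Let `y + z = m • x` and let `w` be a further atom first dividing the multiple `n • x` of `x`.
If `n • x` is a combination of `w` and `z` only, then `m ∤ n`. -/
lemma IsFull.not_dvd_of_smul_eq (hH : IsFull H) {x y z w : ι → ℕ} (hx : IsAtomOf H x)
    (hy : IsAtomOf H y) (hz : IsAtomOf H z) (hw : IsAtomOf H w) (hzx : z ≠ x)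
    (hwx : w ≠ x) (hwy : w ≠ y) {m n e b : ℕ} (hn : 1 ≤ n) (hyz : y + z = m • x)
    (hfac : ∀ u ∈ H, u ≤ (n - 1) • x → ∃ a b c : ℕ, u = a • x + b • y + c • z)
    (hmin : ∀ j : ℕ, w ≤ j • x → n ≤ j) (he : 1 ≤ e) (hb : 1 ≤ b)
    (h : n • x = e • w + b • z) : ¬ m ∣ n := by
  have hle : x ≤ w + z := hH.le_add_of_smul_eq hw hz hx hwx hzx hn h
  have hwz : w + z ≤ n • x := by
    rw [h]
    exact add_le_add (le_self_nsmul zero_le (by omega)) (le_self_nsmul zero_le (by omega))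
  obtain ⟨a, i, c, hv⟩ := hfac (w + z - x) (hH x hx.1 _ (add_mem hw.1 hz.1) hle) (by
    intro j
    have := hwz j
    simp only [Pi.sub_apply, Pi.smul_apply, smul_eq_mul, Nat.sub_mul] at this ⊢
    omega)
  have hp (j : ι) : w j + z j = (a + 1) * x j + i * y j + c * z j := by
    have h1 := congrFun hv j
    have h2 := hle j
    simp only [Pi.sub_apply, Pi.add_apply, Pi.smul_apply, smul_eq_mul] at h1 h2
    rw [add_mul]
    omega
  have hyzp (j : ι) : y j + z j = m * x j := by simpa using congrFun hyz j
  obtain rfl : c = 0 := by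
    by_contra hc
    refine hwx (hH.atom_eq_of_le hx hw fun j => ?_).symm
    have h1 := hp j
    have h2 := Nat.mul_le_mul_right (z j) (Nat.one_le_iff_ne_zero.mpr hc)
    show x j ≤ w j
    rw [add_mul] at h1
    omega
  have ham : a + 1 < m := by
    by_contra! hc
    refine hwy (hH.atom_eq_of_le hy hw fun j => ?_).symm
    have h1 := hp j
    have h2 := hyzp j
    have h3 := Nat.mul_le_mul_right (x j) hc
    show y j ≤ w j
    omega
  have hwi (j : ι) : w j + (i + 1) * z j = (a + 1 + i * m) * x j := by
    linear_combination hp j + i * hyzp j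
  have hnle : n ≤ a + 1 + i * m := hmin _ fun j => by
    simp [← hwi j]
  have heq : e * (a + 1 + i * m) = n := by
    refine hH.coeff_eq hx hz hzx.symm (b := b) (c := e * (i + 1)) ?_
    funext j
    have hj : n * x j = e * w j + b * z j := by simpa using congrFun h j
    simp only [Pi.add_apply, Pi.smul_apply, smul_eq_mul]
    linear_combination hj.symm + e * (hwi j).symm
  have hnn : n = a + 1 + i * m :=
    le_antisymm hnle (heq ▸ Nat.le_mul_of_pos_left _ he)
  intro hd
  rw [hnn, Nat.dvd_add_left (Dvd.intro_left i rfl)] at hd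
  exact absurd (Nat.le_of_dvd (Nat.succ_pos a) hd) (by omega)

/-- If the only atom dividing `(m - 1) • x` is `x`, and those dividing `m • x` are `x, y, z`,
then `y + z = m • x`. -/
lemma IsFull.add_eq_smul [Fintype ι] (hH : IsFull H) {x y z : ι → ℕ} (hx : IsAtomOf H x)
    (hy : IsAtomOf H y) (hz : IsAtomOf H z) (hyx : y ≠ x) (hzx : z ≠ x) {m : ℕ} (hm : 1 ≤ m)
    (h1 : ∀ a, IsAtomOf H a → a ≤ (m - 1) • x → a = x)
    (h3 : ∀ a, IsAtomOf H a → a ≤ m • x → a = x ∨ a = y ∨ a = z) (hym : y ≤ m • x) :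
    y + z = m • x := by
  obtain ⟨a, b, c, d, hu⟩ := exists_eq_combination_of_atoms_le (x := x) (y := y) (z := z) (w := z)
    (hH y hy.1 _ (nsmul_mem hx.1 m) hym) tsub_le_self
    (fun a ha hle => by rcases h3 a ha hle with h | h | h <;> simp [h])
  have hp (j : ι) : m * x j = a * x j + (b + 1) * y j + (c + d) * z j := by
    have e1 := congrFun hu j
    have e2 := hym j
    simp only [Pi.sub_apply, Pi.add_apply, Pi.smul_apply, smul_eq_mul] at e1 e2
    rw [add_mul, add_mul]
    omega
  obtain rfl : a = 0 := by
    by_contra ha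
    refine hyx (h1 y hy fun j => ?_)
    have e1 := hp j
    have e2 := Nat.mul_le_mul_right (x j) (Nat.one_le_iff_ne_zero.mpr ha)
    simp only [Pi.smul_apply, smul_eq_mul, Nat.sub_mul]
    rw [add_mul] at e1
    omega
  have hmx : m • x = (b + 1) • y + (c + d) • z := by
    funext j
    simpa using hp j
  have hcd : 1 ≤ c + d := by
    by_contra! hlt
    obtain h0 : c + d = 0 := by omega
    rw [h0, zero_smul, add_zero] at hmx
    exact hyx (hH.atom_eq_of_smul_eq hx hy hm hmx).symm
  have hle : x ≤ y + z := hH.le_add_of_smul_eq hy hz hx hyx hzx hm hmx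
  have hyzm : y + z ≤ m • x := by
    rw [hmx]
    exact add_le_add (le_self_nsmul zero_le (by omega)) (le_self_nsmul zero_le (by omega))
  obtain ⟨a₁, a₂, a₃, a₄, hv⟩ := exists_eq_combination_of_atoms_le (u := y + z - x) (v := (m - 1) • x)
    (x := x) (y := x) (z := x) (w := x) (hH x hx.1 _ (add_mem hy.1 hz.1) hle) (by
      intro j
      have := hyzm j
      simp only [Pi.sub_apply, Pi.smul_apply, smul_eq_mul, Nat.sub_mul] at this ⊢
      omega)
    (fun a ha hle => Or.inl (h1 a ha hle))
  have hs : y + z = (a₁ + a₂ + a₃ + a₄ + 1) • x := by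
    rw [← tsub_add_cancel_of_le hle, hv]
    module
  have hm1 : m ≤ a₁ + a₂ + a₃ + a₄ + 1 := by
    by_contra! hlt
    refine hyx (h1 y hy ?_)
    calc y ≤ y + z := le_self_add
      _ = _ := hs
      _ ≤ _ := nsmul_le_nsmul_left zero_le (by omega)
  refine le_antisymm hyzm ?_
  rw [hs]
  exact nsmul_le_nsmul_left zero_le hm1

end FullSubmonoid

theorem one_three_four_not_dvd {t : ℕ} (ht : 1 ≤ t)
    (H : AddSubmonoid (Fin t → ℕ)) (hfull : IsFull H) (hfg : H.FG)
    (x : Fin t → ℕ) (hx : IsAtomOf H x) (m n : ℕ) (hm : 2 ≤ m) (hmn : m < n)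
    (h1 : ∀ i : ℕ, 1 ≤ i → i < m → sSeq H x i = 1)
    (h3 : ∀ i : ℕ, m ≤ i → i < n → sSeq H x i = 3)
    (h4 : sSeq H x n = 4) :
    ¬ (m ∣ n) := by
  set D : ℕ → Set (Fin t → ℕ) := fun i => {a | IsAtomOf H a ∧ a ≤ i • x} with hD
  have hs (i : ℕ) : sSeq H x i = (D i).ncard := by
    unfold sSeq
    congr 1
    ext a
    exact and_congr_right fun ha => hfull.dividesIn_iff ha.1 (nsmul_mem hx.1 i)
  have hmono {i j : ℕ} (hij : i ≤ j) : D i ⊆ D j := fun a ha =>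
    ⟨ha.1, ha.2.trans (nsmul_le_nsmul_left zero_le hij)⟩
  have hxD {i : ℕ} (hi : 1 ≤ i) : x ∈ D i := ⟨hx, le_self_nsmul zero_le (by omega)⟩
  have c1 : (D (m - 1)).ncard = 1 := hs _ ▸ h1 _ (by omega) (by omega)
  have c3 : (D m).ncard = 3 := hs _ ▸ h3 _ le_rfl hmn
  have c3' : (D (n - 1)).ncard = 3 := hs _ ▸ h3 _ (by omega) (by omega)
  have c4 : (D n).ncard = 4 := hs _ ▸ h4
  have fin {i : ℕ} (h : (D i).ncard ≠ 0) : (D i).Finite := Set.finite_of_ncard_ne_zero h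
  have only_x : ∀ a, IsAtomOf H a → a ≤ (m - 1) • x → a = x := by
    obtain ⟨x', hx'⟩ := Set.ncard_eq_one.mp c1
    intro a ha hle
    have e1 : a ∈ D (m - 1) := ⟨ha, hle⟩
    have e2 := hxD (i := m - 1) (by omega)
    rw [hx'] at e1 e2
    exact e1.trans e2.symm
  obtain ⟨y, z, hyz, hyzD⟩ := Set.ncard_eq_two.mp
    (show (D m \ {x}).ncard = 2 by
      rw [Set.ncard_sdiff_singleton_of_mem (hxD (by omega)), c3])
  have hDm : ∀ a, IsAtomOf H a → a ≤ m • x → a = x ∨ a = y ∨ a = z := by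
    intro a ha hle
    by_cases hax : a = x
    · exact Or.inl hax
    · have : a ∈ D m \ {x} := ⟨⟨ha, hle⟩, hax⟩
      rw [hyzD] at this
      exact Or.inr this
  obtain ⟨⟨hy, hym⟩, hyx⟩ : y ∈ D m \ {x} := hyzD ▸ by simp
  obtain ⟨⟨hz, hzm⟩, hzx⟩ : z ∈ D m \ {x} := hyzD ▸ by simp
  have hadd : y + z = m • x :=
    hfull.add_eq_smul hx hy hz hyx hzx (by omega) only_x hDm hym
  have hDD : D m = D (n - 1) :=
    Set.eq_of_subset_of_ncard_le (hmono (by omega)) (by omega) (fin (by omega))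
  obtain ⟨w, hwn, hwn'⟩ := Set.exists_mem_notMem_of_ncard_lt_ncard
    (show (D (n - 1)).ncard < (D n).ncard by omega) (fin (by omega))
  have hDn : insert w (D (n - 1)) = D n := by
    refine Set.eq_of_subset_of_ncard_le (Set.insert_subset hwn (hmono (by omega))) ?_
      (fin (by omega))
    rw [Set.ncard_insert_of_notMem hwn' (fin (by omega))]
    omega
  have hw := hwn.1
  have hmin (j : ℕ) (hj : w ≤ j • x) : n ≤ j := by
    by_contra! hlt
    exact hwn' (hmono (show j ≤ n - 1 by omega) ⟨hw, hj⟩)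
  have hwx : w ≠ x := fun h => hwn' (h ▸ hxD (by omega))
  have hwy : w ≠ y := fun h => hwn' (hDD ▸ h ▸ ⟨hy, hym⟩)
  have hwz : w ≠ z := fun h => hwn' (hDD ▸ h ▸ ⟨hz, hzm⟩)
  have hfac (u) (hu : u ∈ H) (hle : u ≤ (n - 1) • x) :
      ∃ a b c : ℕ, u = a • x + b • y + c • z := by
    obtain ⟨a, b, c, d, h⟩ := exists_eq_combination_of_atoms_le (x := x) (y := y) (z := z) (w := z)
      hu hle (fun a ha hle => by
        have : a ∈ D m := hDD ▸ ⟨ha, hle⟩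
        rcases hDm a ha this.2 with h | h | h <;> simp [h])
    exact ⟨a, b, c + d, by rw [h]; module⟩
  obtain ⟨a, b, c, d, hu⟩ := exists_eq_combination_of_atoms_le (x := x) (y := y) (z := z) (w := w)
    (hfull w hw.1 _ (nsmul_mem hx.1 n) hwn.2) tsub_le_self (fun a ha hle => by
      have : a ∈ insert w (D (n - 1)) := hDn ▸ ⟨ha, hle⟩
      rcases this with h | h
      · simp [h]
      · rw [← hDD] at h
        rcases hDm a ha h.2 with h | h | h <;> simp [h])
  have hp (j) : n * x j = a * x j + b * y j + c * z j + (d + 1) * w j := by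
    have e1 := congrFun hu j
    have e2 := hwn.2 j
    simp only [Pi.sub_apply, Pi.add_apply, Pi.smul_apply, smul_eq_mul] at e1 e2
    rw [add_mul d]
    omega
  obtain rfl : a = 0 := by
    by_contra ha
    have : n ≤ n - 1 := hmin _ fun j => by
      have e1 := hp j
      have e2 := Nat.mul_le_mul_right (x j) (Nat.one_le_iff_ne_zero.mpr ha)
      simp only [Pi.smul_apply, smul_eq_mul, Nat.sub_mul]
      rw [add_mul d] at e1
      omega
    omega
  have hbc : b = 0 ∨ c = 0 := by
    by_contra! hcon
    have : n ≤ n - m := hmin _ fun j => by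
      have e1 := hp j
      have e2 := Nat.mul_le_mul_right (y j) (Nat.one_le_iff_ne_zero.mpr hcon.1)
      have e3 := Nat.mul_le_mul_right (z j) (Nat.one_le_iff_ne_zero.mpr hcon.2)
      have e4 : y j + z j = m * x j := by simpa using congrFun hadd j
      simp only [Pi.smul_apply, smul_eq_mul, Nat.sub_mul]
      rw [add_mul d] at e1
      omega
    omega
  have hbc' : ¬ (b = 0 ∧ c = 0) := by
    rintro ⟨rfl, rfl⟩
    refine hwx (hfull.atom_eq_of_smul_eq hx hw (k := n) (l := d + 1) (by omega) ?_).symm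
    funext j
    simpa using hp j
  rcases hbc with rfl | rfl
  · refine hfull.not_dvd_of_smul_eq hx hy hz hw hzx hwx hwy (by omega) hadd hfac hmin
      (e := d + 1) (b := c) (by omega) (by omega) ?_
    funext j
    simpa [add_comm] using hp j
  · refine hfull.not_dvd_of_smul_eq hx hz hy hw hyx hwx hwz (by omega)
      ((add_comm z y).trans hadd) (fun u hu hle => ?_) hmin
      (e := d + 1) (b := b) (by omega) (by omega) ?_
    · obtain ⟨a, b, c, h⟩ := hfac u hu hle
      exact ⟨a, c, b, by rw [h, add_right_comm]⟩
    · funext j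
      simpa [add_comm] using hp j
end

section
/- In the glomming setup, for every n ≥ 1 the number of atoms of the glom G(H₁, H₂) that divide n•(x₀ ⊠ y₀) in G(H₁, H₂) equals s_n(x₀) + s_n(y₀) − 1, where s_n(x₀) is the number of atoms of H₁ dividing n•x₀ in H₁ and s_n(y₀) is the number of atoms of H₂ dividing n•y₀ in H₂. Equivalently, the divisor sequence of x₀ ⊠ y₀ is (s_n(x₀) + s_n(y₀) − 1)_{n≥1}. -/
section Outer

variable {t₁ t₂ : ℕ}

theorem outer_add_left (u u' : Fin t₁ → ℕ) (v : Fin t₂ → ℕ) :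
    outer (u + u') v = outer u v + outer u' v := by
  ext p
  simp [outer, add_mul]

theorem outer_add_right (u : Fin t₁ → ℕ) (v v' : Fin t₂ → ℕ) :
    outer u (v + v') = outer u v + outer u v' := by
  ext p
  simp [outer, mul_add]

theorem outer_zero_left (v : Fin t₂ → ℕ) : outer (0 : Fin t₁ → ℕ) v = 0 := by
  ext p
  simp [outer]

theorem outer_zero_right (u : Fin t₁ → ℕ) : outer u (0 : Fin t₂ → ℕ) = 0 := by
  ext p
  simp [outer]

theorem outer_nsmul_left (n : ℕ) (u : Fin t₁ → ℕ) (v : Fin t₂ → ℕ) :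
    outer (n • u) v = n • outer u v := by
  ext p
  simp [outer, mul_assoc]

theorem outer_nsmul_right (n : ℕ) (u : Fin t₁ → ℕ) (v : Fin t₂ → ℕ) :
    outer u (n • v) = n • outer u v := by
  ext p
  simp [outer, mul_left_comm]

theorem outer_comp_swap (u : Fin t₁ → ℕ) (v : Fin t₂ → ℕ) :
    outer u v ∘ Prod.swap = outer v u := by
  ext p
  simp [outer, mul_comm]

theorem outer_add_outer_comp_swap (a u : Fin t₁ → ℕ) (v b : Fin t₂ → ℕ) :
    (outer a v + outer u b) ∘ Prod.swap = outer b u + outer v a := by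
  rw [← outer_comp_swap a v, ← outer_comp_swap u b, add_comm]
  rfl

theorem outer_left_injective (h : 1 ≤ t₂) {v : Fin t₂ → ℕ} (hv : ∀ l, 0 < v l) :
    Function.Injective fun u : Fin t₁ → ℕ => outer u v := by
  intro u u' huu
  ext k
  have := congrFun huu (k, ⟨0, h⟩)
  simpa [outer, (hv _).ne'] using this

theorem outer_right_injective (h : 1 ≤ t₁) {u : Fin t₁ → ℕ} (hu : ∀ k, 0 < u k) :
    Function.Injective fun v : Fin t₂ → ℕ => outer u v := by
  intro v v' hvv
  ext l
  have := congrFun hvv (⟨0, h⟩, l)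
  simpa [outer, (hu _).ne'] using this

end Outer

section Full

variable {ι : Type*} {H : AddSubmonoid (ι → ℕ)}

/-- In a full submonoid, an element proportional to an atom is a natural multiple of it. -/
theorem IsFull.eq_nsmul_of_proportional (hH : IsFull H) {a c : ι → ℕ} (ha : IsAtomOf H a)
    (hc : c ∈ H) {p q : ℕ} (hq : 0 < q) (h : ∀ k, q * c k = p * a k) : ∃ r : ℕ, c = r • a := by
  have hle : (p / q) • a ≤ c := by
    intro k
    refine Nat.le_of_mul_le_mul_left ?_ hq
    calc q * ((p / q) * a k) = (q * (p / q)) * a k := by ring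
      _ ≤ p * a k := Nat.mul_le_mul_right _ (Nat.mul_div_le p q)
      _ = q * c k := (h k).symm
  obtain ⟨d, rfl⟩ := exists_add_of_le hle
  have hd : d ∈ H := by
    have := hH _ (H.nsmul_mem ha.1 (p / q)) _ hc hle
    rwa [add_tsub_cancel_left] at this
  have hrem : ∀ k, q * d k = (p % q) * a k := by
    intro k
    have h1 := h k
    have h2 := congrArg (· * a k) (Nat.div_add_mod p q)
    simp only [Pi.add_apply, Pi.smul_apply, smul_eq_mul] at h1 h2
    linarith
  have hda : d ≤ a := by
    intro k
    refine Nat.le_of_mul_le_mul_left ?_ hq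
    rw [hrem k]
    exact Nat.mul_le_mul_right _ (Nat.mod_lt p hq).le
  rcases ha.2.2 d (a - d) hd (hH d hd a ha.1 hda) (add_tsub_cancel_of_le hda).symm with h0 | h0
  · exact ⟨p / q, by rw [h0, add_zero]⟩
  · have hda' : d = a := le_antisymm hda (tsub_eq_zero_iff_le.mp h0)
    refine absurd ?_ ha.2.1
    ext k
    by_contra hk
    have := hrem k
    rw [hda'] at this
    exact (Nat.mod_lt p hq).ne' (Nat.eq_of_mul_eq_mul_right (Nat.pos_of_ne_zero hk) this)

/-- If an atom is a sum `a + r • b` with `b` an atom, then `r = 0`, or `r = 1` and `a = 0`. -/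
theorem IsAtomOf.eq_add_nsmul {x a b : ι → ℕ} (hx : IsAtomOf H x) (ha : a ∈ H)
    (hb : IsAtomOf H b) {r : ℕ} (h : x = a + r • b) : r = 0 ∨ (r = 1 ∧ a = 0) := by
  rcases r with _ | r
  · exact Or.inl rfl
  · rcases hx.2.2 b (a + r • b) hb.1 (H.add_mem ha (H.nsmul_mem hb.1 r))
      (by rw [h, succ_nsmul]; abel) with h0 | h0
    · exact absurd h0 hb.2.1
    · obtain ⟨ha0, hr0⟩ := add_eq_zero.mp h0
      have : r = 0 := (smul_eq_zero.mp hr0).resolve_right hb.2.1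
      exact Or.inr ⟨by rw [this], ha0⟩

/-- A submonoid of `ι → ℕ` with `ι` finite is generated by its atoms. -/
theorem mem_closure_atoms [Fintype ι] {a : ι → ℕ} (ha : a ∈ H) :
    a ∈ AddSubmonoid.closure {b | IsAtomOf H b} := by
  induction hs : ∑ k, a k using Nat.strong_induction_on generalizing a with
  | _ s ih =>
    by_cases h0 : a = 0
    · exact h0 ▸ zero_mem _
    by_cases hat : IsAtomOf H a
    · exact AddSubmonoid.subset_closure hat
    · simp only [IsAtomOf, ha, h0, not_forall, true_and, ne_eq, not_false_eq_true,
        not_or] at hat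
      obtain ⟨b, c, hb, hc, rfl, hb0, hc0⟩ := hat
      have pos : ∀ u : ι → ℕ, u ≠ 0 → 0 < ∑ k, u k := by
        intro u hu
        obtain ⟨k, hk⟩ := Function.ne_iff.mp hu
        exact Finset.sum_pos' (fun _ _ => Nat.zero_le _)
          ⟨k, Finset.mem_univ k, Nat.pos_of_ne_zero hk⟩
      have hb1 := pos b hb0
      have hc1 := pos c hc0
      simp only [Pi.add_apply, Finset.sum_add_distrib] at hs
      exact add_mem (ih _ (by omega) hb rfl) (ih _ (by omega) hc rfl)

/-- In a full submonoid, every element divides a multiple of a strictly positive element. -/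
theorem IsFull.exists_dividesIn_nsmul [Fintype ι] (hH : IsFull H) {a b : ι → ℕ} (ha : a ∈ H)
    (hpos : ∀ k, 0 < a k) (hb : b ∈ H) : ∃ n : ℕ, 1 ≤ n ∧ DividesIn H b (n • a) := by
  refine ⟨∑ k, b k + 1, by omega, (∑ k, b k + 1) • a - b, ?_, ?_⟩
  all_goals
    have hle : b ≤ (∑ k, b k + 1) • a := by
      intro k
      have h1 : b k ≤ ∑ k, b k :=
        Finset.single_le_sum (f := b) (fun _ _ => Nat.zero_le _) (Finset.mem_univ k)
      have h2 := hpos k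
      simp only [Pi.smul_apply, smul_eq_mul]
      nlinarith
  · exact hH b hb _ (H.nsmul_mem ha _) hle
  · exact (add_tsub_cancel_of_le hle).symm

/-- If every atom dividing a multiple of a strictly positive element is listed by `x`, then `x`
generates the full submonoid. -/
theorem IsFull.mem_closure_range [Fintype ι] {κ : Type*} (hH : IsFull H) {x : κ → ι → ℕ}
    {a : ι → ℕ} (ha : a ∈ H) (hpos : ∀ k, 0 < a k)
    (hdiv : ∀ b, IsAtomOf H b → (∃ n : ℕ, 1 ≤ n ∧ DividesIn H b (n • a)) → ∃ i, b = x i)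
    {c : ι → ℕ} (hc : c ∈ H) : c ∈ AddSubmonoid.closure (Set.range x) := by
  refine AddSubmonoid.closure_mono ?_ (mem_closure_atoms hc)
  intro b hb
  obtain ⟨i, rfl⟩ := hdiv b hb (hH.exists_dividesIn_nsmul ha hpos hb.1)
  exact ⟨i, rfl⟩

end Full

/-- An atom lying in the submonoid generated by `S` belongs to `S`. -/
theorem IsAtomOf.mem_of_closure {M : Type*} [AddCommMonoid M] {S : Set M} {a : M}
    (ha : IsAtomOf (AddSubmonoid.closure S) a) : a ∈ S := by
  suffices h : ∀ b ∈ AddSubmonoid.closure S, b = a → a ∈ S from h a ha.1 rfl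
  intro b hb
  induction hb using AddSubmonoid.closure_induction with
  | mem b hb => rintro rfl; exact hb
  | zero => intro h; exact absurd h.symm ha.2.1
  | add b c hb hc ihb ihc =>
    intro h
    rcases ha.2.2 b c hb hc h.symm with h0 | h0
    · exact ihc (by rw [← h, h0, zero_add])
    · exact ihb (by rw [← h, h0, add_zero])

theorem DividesIn.self_nsmul {M : Type*} [AddCommMonoid M] {H : AddSubmonoid M} {a : M}
    (ha : a ∈ H) {n : ℕ} (hn : 1 ≤ n) : DividesIn H a (n • a) := by
  obtain ⟨k, rfl⟩ := exists_add_of_le hn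
  exact ⟨k • a, H.nsmul_mem ha k, by rw [add_nsmul, one_nsmul]⟩

section Relations

variable {t₁ t₂ : ℕ} {H₁ : AddSubmonoid (Fin t₁ → ℕ)} {H₂ : AddSubmonoid (Fin t₂ → ℕ)}
  {x₀ : Fin t₁ → ℕ} {y₀ : Fin t₂ → ℕ}

/-- The relations between the two families of generators of the glom. -/
theorem exists_nsmul_of_outer_eq (ht₁ : 1 ≤ t₁) (ht₂ : 1 ≤ t₂) (hH : IsFull H₁)
    (hx : IsAtomOf H₁ x₀) (hxpos : ∀ k, 0 < x₀ k) (hypos : ∀ l, 0 < y₀ l)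
    {a a' : Fin t₁ → ℕ} {b : Fin t₂ → ℕ} (ha : a ∈ H₁) (ha' : a' ∈ H₁)
    (h : outer a y₀ = outer a' y₀ + outer x₀ b) :
    ∃ r : ℕ, a = a' + r • x₀ ∧ b = r • y₀ := by
  have hkl : ∀ k l, a k * y₀ l = a' k * y₀ l + x₀ k * b l := fun k l => congrFun h (k, l)
  have hle : a' ≤ a := fun k =>
    Nat.le_of_mul_le_mul_right (by rw [hkl k ⟨0, ht₂⟩]; omega) (hypos ⟨0, ht₂⟩)
  have hd := hH a' ha' a ha hle
  obtain ⟨d, rfl⟩ := exists_add_of_le hle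
  rw [add_tsub_cancel_left] at hd
  have hdkl : ∀ k l, d k * y₀ l = x₀ k * b l := by
    intro k l
    have := hkl k l
    simp only [Pi.add_apply, add_mul] at this
    omega
  obtain ⟨r, rfl⟩ := hH.eq_nsmul_of_proportional hx hd (hypos ⟨0, ht₂⟩)
    (p := b ⟨0, ht₂⟩) fun k => by rw [mul_comm, hdkl, mul_comm]
  refine ⟨r, rfl, ?_⟩
  ext l
  refine Nat.eq_of_mul_eq_mul_left (hxpos ⟨0, ht₁⟩) ?_
  rw [← hdkl]
  simp only [Pi.smul_apply, smul_eq_mul]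
  ring

/-- A decomposition of `x ⊠ y₀`, with `x` an atom, is trivial. -/
theorem eq_zero_or_eq_zero_of_outer_eq (ht₁ : 1 ≤ t₁) (ht₂ : 1 ≤ t₂) (hH : IsFull H₁)
    (hx₀ : IsAtomOf H₁ x₀) (hy₀ : IsAtomOf H₂ y₀) (hxpos : ∀ k, 0 < x₀ k)
    (hypos : ∀ l, 0 < y₀ l) {x : Fin t₁ → ℕ} (hx : IsAtomOf H₁ x)
    {a a' : Fin t₁ → ℕ} {b b' : Fin t₂ → ℕ} (ha : a ∈ H₁) (ha' : a' ∈ H₁)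
    (hb : b ∈ H₂) (hb' : b' ∈ H₂)
    (h : outer x y₀ = (outer a y₀ + outer x₀ b) + (outer a' y₀ + outer x₀ b')) :
    (a = 0 ∧ b = 0) ∨ (a' = 0 ∧ b' = 0) := by
  obtain ⟨r, hxr, hbr⟩ := exists_nsmul_of_outer_eq ht₁ ht₂ hH hx₀ hxpos hypos hx.1
    (H₁.add_mem ha ha') (b := b + b')
    (by rw [h, outer_add_left, outer_add_right]; abel)
  rcases hx.eq_add_nsmul (H₁.add_mem ha ha') hx₀ hxr with rfl | ⟨rfl, h0⟩
  · rw [zero_nsmul, add_zero] at hxr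
    rw [zero_nsmul, add_eq_zero] at hbr
    exact (hx.2.2 a a' ha ha' hxr).imp (⟨·, hbr.1⟩) (⟨·, hbr.2⟩)
  · rw [one_nsmul] at hbr
    rw [add_eq_zero] at h0
    exact (hy₀.2.2 b b' hb hb' hbr.symm).imp (⟨h0.1, ·⟩) (⟨h0.2, ·⟩)

/-- A divisor `x ⊠ y₀` of `n • (x₀ ⊠ y₀)` comes from a divisor `x` of `n • x₀`. -/
theorem dividesIn_of_outer_eq (ht₁ : 1 ≤ t₁) (ht₂ : 1 ≤ t₂) (hH : IsFull H₁)
    (hx₀ : IsAtomOf H₁ x₀) (hxpos : ∀ k, 0 < x₀ k) (hypos : ∀ l, 0 < y₀ l)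
    {x a : Fin t₁ → ℕ} {b : Fin t₂ → ℕ} (hx : x ∈ H₁) (ha : a ∈ H₁) {n : ℕ}
    (h : n • outer x₀ y₀ = outer x y₀ + (outer a y₀ + outer x₀ b)) :
    DividesIn H₁ x (n • x₀) := by
  obtain ⟨r, hr, -⟩ := exists_nsmul_of_outer_eq ht₁ ht₂ hH hx₀ hxpos hypos
    (H₁.nsmul_mem hx₀.1 n) (H₁.add_mem hx ha) (b := b)
    (by rw [outer_nsmul_left, h, outer_add_left]; abel)
  exact ⟨a + r • x₀, H₁.add_mem ha (H₁.nsmul_mem hx₀.1 r), by rw [hr, add_assoc]⟩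

end Relations

section Glom

variable {t₁ t₂ m n' : ℕ} {H₁ : AddSubmonoid (Fin t₁ → ℕ)} {H₂ : AddSubmonoid (Fin t₂ → ℕ)}
  {x : Fin (m + 1) → Fin t₁ → ℕ} {y : Fin (n' + 1) → Fin t₂ → ℕ}

theorem outer_left_mem_glom {a : Fin t₁ → ℕ} (ha : a ∈ AddSubmonoid.closure (Set.range x)) :
    outer a (y 0) ∈ glom x y := by
  induction ha using AddSubmonoid.closure_induction with
  | mem a ha =>
    obtain ⟨i, rfl⟩ := ha
    exact AddSubmonoid.subset_closure (Or.inl ⟨i, rfl⟩)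
  | zero => rw [outer_zero_left]; exact zero_mem _
  | add a b _ _ iha ihb => rw [outer_add_left]; exact add_mem iha ihb

theorem outer_right_mem_glom {b : Fin t₂ → ℕ} (hb : b ∈ AddSubmonoid.closure (Set.range y)) :
    outer (x 0) b ∈ glom x y := by
  induction hb using AddSubmonoid.closure_induction with
  | mem b hb =>
    obtain ⟨j, rfl⟩ := hb
    exact AddSubmonoid.subset_closure (Or.inr ⟨j, rfl⟩)
  | zero => rw [outer_zero_right]; exact zero_mem _
  | add a b _ _ iha ihb => rw [outer_add_right]; exact add_mem iha ihb

theorem exists_eq_of_mem_glom (hx : ∀ i, x i ∈ H₁) (hy : ∀ j, y j ∈ H₂)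
    {w : Fin t₁ × Fin t₂ → ℕ} (hw : w ∈ glom x y) :
    ∃ a ∈ H₁, ∃ b ∈ H₂, w = outer a (y 0) + outer (x 0) b := by
  induction hw using AddSubmonoid.closure_induction with
  | mem w hw =>
    rcases hw with ⟨i, rfl⟩ | ⟨j, rfl⟩
    · exact ⟨x i, hx i, 0, zero_mem _, by rw [outer_zero_right, add_zero]⟩
    · exact ⟨0, zero_mem _, y j, hy j, by rw [outer_zero_left, zero_add]⟩
  | zero => exact ⟨0, zero_mem _, 0, zero_mem _, by rw [outer_zero_left, outer_zero_right, add_zero]⟩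
  | add w w' _ _ ihw ihw' =>
    obtain ⟨a, ha, b, hb, rfl⟩ := ihw
    obtain ⟨a', ha', b', hb', rfl⟩ := ihw'
    exact ⟨a + a', add_mem ha ha', b + b', add_mem hb hb', by
      rw [outer_add_left, outer_add_right]; abel⟩

theorem isAtomOf_outer_left (ht₁ : 1 ≤ t₁) (ht₂ : 1 ≤ t₂) (hH : IsFull H₁)
    (hx : ∀ i, IsAtomOf H₁ (x i)) (hy : ∀ j, IsAtomOf H₂ (y j)) (hxpos : ∀ k, 0 < x 0 k)
    (hypos : ∀ l, 0 < y 0 l) (i : Fin (m + 1)) : IsAtomOf (glom x y) (outer (x i) (y 0)) := by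
  refine ⟨AddSubmonoid.subset_closure (Or.inl ⟨i, rfl⟩), fun h => (hx i).2.1 ?_, ?_⟩
  · exact outer_left_injective ht₂ hypos (h.trans (outer_zero_left _).symm)
  · intro w w' hw hw' h
    obtain ⟨a, ha, b, hb, rfl⟩ := exists_eq_of_mem_glom (fun i => (hx i).1) (fun j => (hy j).1) hw
    obtain ⟨a', ha', b', hb', rfl⟩ :=
      exists_eq_of_mem_glom (fun i => (hx i).1) (fun j => (hy j).1) hw'
    refine (eq_zero_or_eq_zero_of_outer_eq ht₁ ht₂ hH (hx 0) (hy 0) hxpos hypos (hx i)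
      ha ha' hb hb' h).imp ?_ ?_
    all_goals
      rintro ⟨rfl, rfl⟩
      rw [outer_zero_left, outer_zero_right, add_zero]

theorem isAtomOf_outer_right (ht₁ : 1 ≤ t₁) (ht₂ : 1 ≤ t₂) (hH : IsFull H₂)
    (hx : ∀ i, IsAtomOf H₁ (x i)) (hy : ∀ j, IsAtomOf H₂ (y j)) (hxpos : ∀ k, 0 < x 0 k)
    (hypos : ∀ l, 0 < y 0 l) (j : Fin (n' + 1)) : IsAtomOf (glom x y) (outer (x 0) (y j)) := by
  refine ⟨AddSubmonoid.subset_closure (Or.inr ⟨j, rfl⟩), fun h => (hy j).2.1 ?_, ?_⟩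
  · exact outer_right_injective ht₁ hxpos (h.trans (outer_zero_right _).symm)
  · intro w w' hw hw' h
    obtain ⟨a, ha, b, hb, rfl⟩ := exists_eq_of_mem_glom (fun i => (hx i).1) (fun j => (hy j).1) hw
    obtain ⟨a', ha', b', hb', rfl⟩ :=
      exists_eq_of_mem_glom (fun i => (hx i).1) (fun j => (hy j).1) hw'
    refine (eq_zero_or_eq_zero_of_outer_eq ht₂ ht₁ hH (hy 0) (hx 0) hypos hxpos (hy j)
      hb hb' ha ha' ?_).imp ?_ ?_
    · rw [← outer_add_outer_comp_swap a, ← outer_add_outer_comp_swap a',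
        ← outer_comp_swap (x 0) (y j)]
      exact congrArg (· ∘ Prod.swap) h
    all_goals
      rintro ⟨rfl, rfl⟩
      rw [outer_zero_left, outer_zero_right, add_zero]

end Glom

theorem glom_divisor_sequence {t₁ t₂ m n' : ℕ} (ht₁ : 1 ≤ t₁) (ht₂ : 1 ≤ t₂)
    (H₁ : AddSubmonoid (Fin t₁ → ℕ)) (H₂ : AddSubmonoid (Fin t₂ → ℕ))
    (hfull₁ : IsFull H₁) (hnorm₁ : IsNormal H₁)
    (hfull₂ : IsFull H₂) (hnorm₂ : IsNormal H₂)
    (x : Fin (m + 1) → Fin t₁ → ℕ) (y : Fin (n' + 1) → Fin t₂ → ℕ)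
    (hxatom : ∀ i, IsAtomOf H₁ (x i)) (hxinj : Function.Injective x)
    (hx0pos : ∀ k, 0 < x 0 k)
    (hxdiv : ∀ b : Fin t₁ → ℕ, IsAtomOf H₁ b →
      (∃ n : ℕ, 1 ≤ n ∧ DividesIn H₁ b (n • x 0)) → ∃ i, b = x i)
    (hyatom : ∀ j, IsAtomOf H₂ (y j)) (hyinj : Function.Injective y)
    (hy0pos : ∀ l, 0 < y 0 l)
    (hydiv : ∀ b : Fin t₂ → ℕ, IsAtomOf H₂ b →
      (∃ n : ℕ, 1 ≤ n ∧ DividesIn H₂ b (n • y 0)) → ∃ j, b = y j) :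
    ∀ n : ℕ, 1 ≤ n →
      sSeq (glom x y) (outer (x 0) (y 0)) n = sSeq H₁ (x 0) n + sSeq H₂ (y 0) n - 1 := by
  intro n hn
  have hxmem : ∀ i, x i ∈ H₁ := fun i => (hxatom i).1
  have hymem : ∀ j, y j ∈ H₂ := fun j => (hyatom j).1
  have hxle {u} (hu : IsAtomOf H₁ u) (hd : DividesIn H₁ u (n • x 0)) : ∃ i, u = x i :=
    hxdiv u hu ⟨n, hn, hd⟩
  have hyle {v} (hv : IsAtomOf H₂ v) (hd : DividesIn H₂ v (n • y 0)) : ∃ j, v = y j :=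
    hydiv v hv ⟨n, hn, hd⟩
  set S₁ := {u | IsAtomOf H₁ u ∧ DividesIn H₁ u (n • x 0)}
  set S₂ := {v | IsAtomOf H₂ v ∧ DividesIn H₂ v (n • y 0)}
  have hset : {w | IsAtomOf (glom x y) w ∧ DividesIn (glom x y) w (n • outer (x 0) (y 0))} =
      (fun u => outer u (y 0)) '' S₁ ∪ (fun v => outer (x 0) v) '' S₂ := by
    ext w
    constructor
    · rintro ⟨hw, c, hc, hwc⟩
      obtain ⟨a, ha, b, hb, rfl⟩ := exists_eq_of_mem_glom hxmem hymem hc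
      rcases hw.mem_of_closure with ⟨i, rfl⟩ | ⟨j, rfl⟩
      · exact Or.inl ⟨x i, ⟨hxatom i, dividesIn_of_outer_eq ht₁ ht₂ hfull₁ (hxatom 0) hx0pos
          hy0pos (hxmem i) ha hwc⟩, rfl⟩
      · refine Or.inr ⟨y j, ⟨hyatom j, dividesIn_of_outer_eq ht₂ ht₁ hfull₂ (hyatom 0) hy0pos
          hx0pos (hymem j) hb (b := a) ?_⟩, rfl⟩
        rw [← outer_add_outer_comp_swap, ← outer_comp_swap (x 0) (y j),
          ← outer_comp_swap (x 0) (y 0)]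
        exact congrArg (· ∘ Prod.swap) hwc
    · rintro (⟨u, ⟨hu, hd⟩, rfl⟩ | ⟨v, ⟨hv, hd⟩, rfl⟩)
      · obtain ⟨i, rfl⟩ := hxle hu hd
        obtain ⟨c, hc, hcn⟩ := hd
        refine ⟨isAtomOf_outer_left ht₁ ht₂ hfull₁ hxatom hyatom hx0pos hy0pos i,
          outer c (y 0), outer_left_mem_glom (hfull₁.mem_closure_range (hxmem 0) hx0pos hxdiv hc),
          ?_⟩
        rw [← outer_nsmul_left, hcn, outer_add_left]
      · obtain ⟨j, rfl⟩ := hyle hv hd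
        obtain ⟨c, hc, hcn⟩ := hd
        refine ⟨isAtomOf_outer_right ht₁ ht₂ hfull₂ hxatom hyatom hx0pos hy0pos j,
          outer (x 0) c, outer_right_mem_glom (hfull₂.mem_closure_range (hymem 0) hy0pos hydiv hc),
          ?_⟩
        rw [← outer_nsmul_right, hcn, outer_add_right]
  have hself₁ : x 0 ∈ S₁ := ⟨hxatom 0, DividesIn.self_nsmul (hxmem 0) hn⟩
  have hself₂ : y 0 ∈ S₂ := ⟨hyatom 0, DividesIn.self_nsmul (hymem 0) hn⟩
  have hinter : (fun u => outer u (y 0)) '' S₁ ∩ (fun v => outer (x 0) v) '' S₂ =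
      {outer (x 0) (y 0)} := by
    ext w
    constructor
    · rintro ⟨⟨u, ⟨hu, -⟩, rfl⟩, v, ⟨hv, -⟩, huv⟩
      obtain ⟨r, hur, hvr⟩ := exists_nsmul_of_outer_eq ht₁ ht₂ hfull₁ (hxatom 0) hx0pos hy0pos
        hu.1 H₁.zero_mem (b := v) (by rw [outer_zero_left, zero_add]; exact huv.symm)
      rcases hu.eq_add_nsmul H₁.zero_mem (hxatom 0) hur with rfl | ⟨rfl, -⟩
      · exact absurd (by rw [hvr, zero_nsmul]) hv.2.1
      · rw [zero_add, one_nsmul] at hur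
        rw [hur]
        rfl
    · rintro rfl
      exact ⟨⟨x 0, hself₁, rfl⟩, y 0, hself₂, rfl⟩
  have hfin₁ : S₁.Finite := (Set.finite_range x).subset fun u hu =>
    (hxle hu.1 hu.2).imp fun _ h => h.symm
  have hfin₂ : S₂.Finite := (Set.finite_range y).subset fun v hv =>
    (hyle hv.1 hv.2).imp fun _ h => h.symm
  have hcard := Set.ncard_union_add_ncard_inter _ _ (hfin₁.image fun u => outer u (y 0))
    (hfin₂.image fun v => outer (x 0) v)
  rw [← hset, hinter, Set.ncard_singleton,
    Set.ncard_image_of_injective _ (outer_left_injective ht₂ hy0pos),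
    Set.ncard_image_of_injective _ (outer_right_injective ht₁ hx0pos)] at hcard
  exact Nat.eq_sub_of_add_eq hcard
end
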